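/- A finite tree G is friendly to the simple path with |E(G)| edges (in the sense of friendly numberings) if and only if the simple path with |E(G)| edges is friendly to G (in the general sense of friendly bijections of edge sets). -/

import Mathlib

open SimpleGraph

/-- `p` does not catch `q` in `G`: they are disjoint and for any two distinct edges of `p`,
the path in `G` between them contains an even number of edges of `q`. -/
def DoesNotCatch {V : Type*} (G : SimpleGraph V) (p q : Set (Sym2 V)) : Prop :=
  p ∩ q = ∅ ∧
    ∀ e ∈ p, ∀ f ∈ p, e ≠ f →
      ∀ (u v : V) (w : G.Walk u v), w.IsPath → u ∈ e → v ∈ f →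
        e ∉ w.edges → f ∉ w.edges →
        Even (w.edges.countP (fun x => @decide (x ∈ q) (Classical.propDecidable _)))

/-- `p` and `q` are unlinked in `G`. -/
def Unlinked {V : Type*} (G : SimpleGraph V) (p q : Set (Sym2 V)) : Prop :=
  DoesNotCatch G p q ∧ DoesNotCatch G q p

/-- Image of a set of edges of `G₁` under a map of edge sets. -/
def edgeImage {V₁ V₂ : Type*} {G₁ : SimpleGraph V₁} {G₂ : SimpleGraph V₂}
    (φ : G₁.edgeSet → G₂.edgeSet) (s : Set (Sym2 V₁)) : Set (Sym2 V₂) :=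
  {e₂ | ∃ e₁ : G₁.edgeSet, (e₁ : Sym2 V₁) ∈ s ∧ (φ e₁ : Sym2 V₂) = e₂}

/-- A bijection of edge sets is friendly if the images of the coboundaries (incidence sets)
of any two distinct vertices at even distance are unlinked. -/
def FriendlyBij {V₁ V₂ : Type*} (G₁ : SimpleGraph V₁) (G₂ : SimpleGraph V₂)
    (φ : G₁.edgeSet ≃ G₂.edgeSet) : Prop :=
  ∀ P Q : V₁, P ≠ Q → Even (G₁.dist P Q) →
    Unlinked G₂ (edgeImage φ (G₁.incidenceSet P)) (edgeImage φ (G₁.incidenceSet Q))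

/-- `G₁` is friendly to `G₂`. -/
def Friendly {V₁ V₂ : Type*} (G₁ : SimpleGraph V₁) (G₂ : SimpleGraph V₂) : Prop :=
  ∃ φ : G₁.edgeSet ≃ G₂.edgeSet, FriendlyBij G₁ G₂ φ

/-- `G` (a tree) is friendly to the simple path: there is a numbering of its edges
(here `f i` is the edge receiving number `i + 1`) such that for all `k`, `a` of the same
parity (`a = k + 2s`), the path in `G` between the edges numbered `k` and `k + 1` contains
the edge numbered `a` iff it contains the edge numbered `a + 1`. -/
def FriendlyToPath {V : Type*} [Fintype V] [DecidableEq V] (G : SimpleGraph V)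
    [DecidableRel G.Adj] : Prop :=
  ∃ f : Fin G.edgeFinset.card → Sym2 V,
    (∀ i, f i ∈ G.edgeFinset) ∧ Function.Injective f ∧
    ∀ (k a : ℕ) (hk : k + 1 < G.edgeFinset.card) (ha : a + 1 < G.edgeFinset.card),
      a % 2 = k % 2 →
      ∀ (u v : V) (w : G.Walk u v), w.IsPath →
        u ∈ f ⟨k, Nat.lt_of_succ_lt hk⟩ → v ∈ f ⟨k + 1, hk⟩ →
        f ⟨k, Nat.lt_of_succ_lt hk⟩ ∉ w.edges → f ⟨k + 1, hk⟩ ∉ w.edges →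
        (f ⟨a, Nat.lt_of_succ_lt ha⟩ ∈ w.edges ↔ f ⟨a + 1, ha⟩ ∈ w.edges)

section

open Finset

/-- `k`-th partial sum of the difference of columns `u` and `u + 1`. -/
def colDiff (N : ℕ → ℕ → ZMod 2) (k u : ℕ) : ZMod 2 :=
  ∑ h ∈ range k, (N h u + N h (u + 1))

theorem colDiff_succ (N : ℕ → ℕ → ZMod 2) (k u : ℕ) :
    colDiff N (k + 1) u = colDiff N k u + (N k u + N k (u + 1)) := by
  simp [colDiff, sum_range_succ]

theorem sum_range_abel (M c : ℕ → ZMod 2) (n : ℕ) :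
    ∑ u ∈ range n, (M u + M (u + 1)) * c (u + 1) + M n * c (n + 1)
      = M 0 * c 0 + ∑ h ∈ range (n + 1), M h * (c h + c (h + 1)) := by
  induction n with
  | zero => simp; grind
  | succ n ih => rw [sum_range_succ, sum_range_succ _ (n + 1)]; grind

theorem colDiff_idem {n : ℕ} {N : ℕ → ℕ → ZMod 2}
    (hcol : ∀ x < n, ∑ h ∈ range n, N h x = 1)
    (hid : ∀ h < n, ∀ x < n, ∑ u ∈ range n, N h u * N u x = N h x)
    {k l : ℕ} (hk : k ≤ n) (hl : l + 1 < n) :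
    ∑ u ∈ range (n - 1), colDiff N k u * colDiff N (u + 1) l = colDiff N k l := by
  obtain ⟨n, rfl⟩ : ∃ m, n = m + 1 := ⟨n - 1, by omega⟩
  have htot : colDiff N (n + 1) l = 0 := by
    rw [colDiff, sum_add_distrib, hcol _ (by omega), hcol _ hl]; decide
  have h0 : colDiff N 0 l = 0 := by simp [colDiff]
  have h := sum_range_abel (fun u => ∑ h ∈ range k, N h u) (fun u => colDiff N u l) n
  simp only [htot, h0, mul_zero, add_zero, zero_add] at h
  have e : ∀ u, ∑ h ∈ range k, N h u + ∑ h ∈ range k, N h (u + 1) = colDiff N k u := by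
    intro u; rw [colDiff, sum_add_distrib]
  simp only [e] at h
  rw [Nat.add_sub_cancel, h]
  have e2 : ∀ x, colDiff N x l + colDiff N (x + 1) l = N x l + N x (l + 1) := by
    intro x; rw [colDiff_succ]; grind
  simp only [e2, sum_mul]
  rw [sum_comm, colDiff]
  refine sum_congr rfl fun h hh => ?_
  have hh := mem_range.1 hh
  simp only [mul_add, sum_add_distrib]
  rw [hid _ (by omega) _ (by omega), hid _ (by omega) _ hl]

theorem ZMod.eq_one_of_ne_zero {a : ZMod 2} (h : a ≠ 0) : a = 1 := by
  revert a; decide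

theorem sum_range_even_odd (g : ℕ → ZMod 2) (m : ℕ) :
    ∑ u ∈ range m, g u
      = ∑ t ∈ range ((m + 1) / 2), g (2 * t) + ∑ l ∈ range (m / 2), g (2 * l + 1) := by
  induction m with
  | zero => simp
  | succ m ih =>
    rw [sum_range_succ, ih]
    rcases Nat.even_or_odd' m with ⟨c, rfl | rfl⟩
    · rw [show (2 * c + 1 + 1) / 2 = c + 1 by omega, show (2 * c + 1) / 2 = c by omega,
        show 2 * c / 2 = c by omega, sum_range_succ]
      ring
    · rw [show (2 * c + 1 + 1 + 1) / 2 = c + 1 by omega, show (2 * c + 1 + 1) / 2 = c + 1 by omega,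
        show (2 * c + 1) / 2 = c by omega, sum_range_succ (fun l => g (2 * l + 1))]
      ring

/-- `l` if `ε` vanishes below `l`, and otherwise one more than the largest index below `l`
at which `ε` does not vanish. -/
def prevTube (ε : ℕ → ZMod 2) : ℕ → ℕ
  | 0 => 0
  | l + 1 => if ε l = 0 then prevTube ε l else l + 1

theorem prevTube_le (ε : ℕ → ZMod 2) (l : ℕ) : prevTube ε l ≤ l := by
  induction l with
  | zero => simp [prevTube]
  | succ l ih => rw [prevTube]; split_ifs <;> omega

theorem prevTube_eq_zero_or (ε : ℕ → ZMod 2) (l : ℕ) :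
    prevTube ε l = 0 ∨ ∃ q < l, prevTube ε l = q + 1 ∧ ε q = 1 := by
  induction l with
  | zero => simp [prevTube]
  | succ l ih =>
    rw [prevTube]
    split_ifs with h
    · rcases ih with h | ⟨q, hq, h⟩
      · exact .inl h
      · exact .inr ⟨q, by omega, h⟩
    · exact .inr ⟨l, by omega, rfl, ZMod.eq_one_of_ne_zero h⟩

theorem lt_prevTube {ε : ℕ → ZMod 2} {q l : ℕ} (hq : q < l) (h : ε q ≠ 0) :
    q < prevTube ε l := by
  induction l with
  | zero => omega
  | succ l ih =>
    rw [prevTube]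
    split_ifs with h'
    · exact ih (by rcases Nat.lt_succ_iff_lt_or_eq.1 hq with h1 | rfl; exacts [h1, absurd h' h])
    · omega

theorem sum_range_prevTube (ε c : ℕ → ZMod 2) (l : ℕ) :
    ∑ i ∈ range (prevTube ε l), ε i * c i = ∑ i ∈ range l, ε i * c i := by
  induction l with
  | zero => simp [prevTube]
  | succ l ih =>
    rw [prevTube]
    split_ifs with h
    · rw [ih, sum_range_succ, h]; simp
    · rfl

/-- The lower position of the `l`-th pair obtained by cutting and rejoining along the
nonzero values of `ε`. -/
def lowerEnd (ε : ℕ → ZMod 2) (l : ℕ) : ℕ :=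
  if ε l = 0 then 2 * l + 1 else 2 * prevTube ε l - 1

theorem column_relation {ε X G : ℕ → ZMod 2} (hG : G 0 = 0) {b : ℕ}
    (hX : ∀ t < b, X (2 * t + 1) + X (2 * t + 2)
      + ε t * ∑ i ∈ range (t + 1), (X (2 * i) + X (2 * i + 1)) = ε t * G (t + 1))
    {t : ℕ} (ht : t < b) :
    X (lowerEnd ε t) + X (2 * t + 2)
      = if ε t = 0 then 0 else G (prevTube ε t) + G (t + 1) := by
  have hpair : ∀ t, ∑ i ∈ range (t + 1), (X (2 * i) + X (2 * i + 1))
      = ∑ i ∈ range (2 * t + 1), X i + X (2 * t + 1) := by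
    intro t
    induction t with
    | zero => simp
    | succ t ih =>
      rw [sum_range_succ, ih, show 2 * (t + 1) + 1 = 2 * t + 1 + 1 + 1 by ring,
        sum_range_succ _ (2 * t + 1 + 1), sum_range_succ _ (2 * t + 1)]
      rw [show 2 * (t + 1) = 2 * t + 1 + 1 by ring]
      ring
  have key : ∀ t ≤ b, ∑ i ∈ range (2 * t + 1), X i
      = X (2 * prevTube ε t - 1) + G (prevTube ε t) := by
    intro t
    induction t with
    | zero => simp [prevTube, hG]
    | succ t ih =>
      intro ht
      have h := hX t ht
      rw [hpair, ih (by omega)] at h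
      rw [show 2 * (t + 1) + 1 = 2 * t + 1 + 1 + 1 by ring,
        sum_range_succ _ (2 * t + 1 + 1), sum_range_succ _ (2 * t + 1), ih (by omega), prevTube]
      rw [show 2 * t + 1 + 1 = 2 * t + 2 by ring]
      split_ifs with h0
      · rw [h0] at h; grind
      · rw [ZMod.eq_one_of_ne_zero h0] at h
        rw [show 2 * (t + 1) - 1 = 2 * t + 1 by omega]
        grind
  have h := hX t ht
  rw [hpair, key t ht.le] at h
  rw [lowerEnd]
  split_ifs with h0
  · rw [h0] at h; grind
  · rw [ZMod.eq_one_of_ne_zero h0] at h; grind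

/-- A `ZMod 2`-matrix on `n` positions which is idempotent with odd columns, and in which
consecutive pairs of positions of equal parity are unlinked. -/
structure UnlinkedMatrix (n : ℕ) (N : ℕ → ℕ → ZMod 2) : Prop where
  col : ∀ x < n, ∑ h ∈ range n, N h x = 1
  idem : ∀ h < n, ∀ x < n, ∑ u ∈ range n, N h u * N u x = N h x
  weak : ∀ k a, k + 1 < n → a + 1 < n → k % 2 = a % 2 → k ≠ a →
    N a k + N a (k + 1) + (N (a + 1) k + N (a + 1) (k + 1)) = 0
  last : n % 2 = 1 ∨ ∀ j, 2 * j + 2 < n → N (n - 1) (2 * j + 1) + N (n - 1) (2 * j + 2) = 0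

/-- Whether the position `0` separates the positions `2 * j + 1` and `2 * j + 2`. -/
def frontCross (N : ℕ → ℕ → ZMod 2) (j : ℕ) : ZMod 2 := N 0 (2 * j + 1) + N 0 (2 * j + 2)

namespace UnlinkedMatrix

variable {n : ℕ} {N : ℕ → ℕ → ZMod 2} (H : UnlinkedMatrix n N)
include H

theorem colDiff_last {l : ℕ} (hl : l + 1 < n) : colDiff N n l = 0 := by
  rw [colDiff, sum_add_distrib, H.col _ (by omega), H.col _ hl]; decide

theorem colDiff_even_even {k i : ℕ} (hk : 2 * k ≤ n) (hi : 2 * i + 1 < n) :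
    colDiff N (2 * k) (2 * i) = if i < k then colDiff N (2 * i + 2) (2 * i) else 0 := by
  induction k with
  | zero => simp [colDiff]
  | succ k ih =>
    have ih := ih (by omega)
    rcases eq_or_ne i k with rfl | h
    · rw [if_pos (by omega)]; rfl
    · have h1 : colDiff N (2 * (k + 1)) (2 * i) = colDiff N (2 * k) (2 * i) := by
        rw [show 2 * (k + 1) = 2 * k + 1 + 1 by ring, colDiff_succ, colDiff_succ, add_assoc,
          H.weak (2 * i) (2 * k) (by omega) (by omega) (by omega) (by omega), add_zero]
      rw [h1, ih]
      exact if_congr (by omega) rfl rfl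

theorem colDiff_odd_odd {k j : ℕ} (hk : 2 * k + 1 ≤ n) (hj : 2 * j + 2 < n) :
    colDiff N (2 * k + 1) (2 * j + 1) = if k ≤ j then frontCross N j else 0 := by
  have step : ∀ k, 2 * k + 3 ≤ n → k ≠ j →
      colDiff N (2 * (k + 1) + 1) (2 * j + 1) = colDiff N (2 * k + 1) (2 * j + 1) := by
    intro k hk h
    rw [show 2 * (k + 1) + 1 = 2 * k + 1 + 1 + 1 by ring, colDiff_succ, colDiff_succ N (2 * k + 1),
      add_assoc,
      H.weak (2 * j + 1) (2 * k + 1) (by omega) (by omega) (by omega) (by omega), add_zero]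
  split_ifs with h
  · induction k with
    | zero => simp [colDiff, frontCross]
    | succ k ih => rw [step k (by omega) (by omega), ih (by omega) (by omega)]
  · have top : colDiff N (2 * ((n - 1) / 2) + 1) (2 * j + 1) = 0 := by
      have hl := H.colDiff_last (l := 2 * j + 1) (by omega)
      rcases Nat.even_or_odd' n with ⟨c, hc | hc⟩
      · rw [show 2 * ((n - 1) / 2) + 1 = n - 1 by omega]
        obtain ⟨n, rfl⟩ : ∃ m, n = m + 1 := ⟨n - 1, by omega⟩
        rw [colDiff_succ] at hl
        have := (H.last.resolve_left (by omega)) j hj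
        simp only [Nat.add_sub_cancel] at this ⊢
        rw [← hl, this, add_zero]
      · rwa [show 2 * ((n - 1) / 2) + 1 = n by omega]
    have down : ∀ d, d + k ≤ (n - 1) / 2 →
        colDiff N (2 * (k + d) + 1) (2 * j + 1) = colDiff N (2 * k + 1) (2 * j + 1) := by
      intro d
      induction d with
      | zero => simp
      | succ d ih =>
        intro hd
        rw [← add_assoc, step _ (by omega) (by omega), ih (by omega)]
    rw [← down ((n - 1) / 2 - k) (by omega), show k + ((n - 1) / 2 - k) = (n - 1) / 2 by omega, top]

end UnlinkedMatrix

/-- The row of crossing data of the first `k` positions, corrected by the even columns. -/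
def crossSum (N : ℕ → ℕ → ZMod 2) (k j : ℕ) : ZMod 2 :=
  colDiff N k (2 * j + 1) + frontCross N j * ∑ i ∈ range (j + 1), colDiff N k (2 * i)

theorem crossSum_succ_add (N : ℕ → ℕ → ZMod 2) (a j : ℕ) :
    crossSum N (a + 1) j + crossSum N a j = N a (2 * j + 1) + N a (2 * j + 2)
      + frontCross N j * ∑ i ∈ range (j + 1), (N a (2 * i) + N a (2 * i + 1)) := by
  simp only [crossSum, colDiff_succ, sum_add_distrib (f := fun i => colDiff N a (2 * i))]
  grind

namespace UnlinkedMatrix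

variable {n : ℕ} {N : ℕ → ℕ → ZMod 2} (H : UnlinkedMatrix n N)
include H

theorem crossSum_odd {i j : ℕ} (hi : 2 * i + 1 ≤ n) (hj : 2 * j + 2 < n) :
    crossSum N (2 * i + 1) j
      = ∑ l ∈ range ((n - 1) / 2), frontCross N l * colDiff N (2 * l + 2) (2 * j + 1)
        + ∑ l ∈ range i, frontCross N l * colDiff N (2 * l + 2) (2 * j + 1) := by
  have h := colDiff_idem H.col H.idem hi (l := 2 * j + 1) hj
  rw [sum_range_even_odd] at h
  have e1 : ∑ t ∈ range ((n - 1 + 1) / 2), colDiff N (2 * i + 1) (2 * t)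
      * colDiff N (2 * t + 1) (2 * j + 1)
      = frontCross N j * ∑ t ∈ range (j + 1), colDiff N (2 * i + 1) (2 * t) := by
    rw [mul_sum, ← sum_subset (range_subset_range.2 (show j + 1 ≤ (n - 1 + 1) / 2 by omega))]
    · refine sum_congr rfl fun t ht => ?_
      have := mem_range.1 ht
      rw [H.colDiff_odd_odd (by omega) hj, if_pos (by omega), mul_comm]
    · intro t ht ht'
      rw [mem_range] at ht ht'
      rw [H.colDiff_odd_odd (by omega) hj, if_neg (by omega), mul_zero]
  have e2 : ∑ l ∈ range ((n - 1) / 2), colDiff N (2 * i + 1) (2 * l + 1)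
      * colDiff N (2 * l + 1 + 1) (2 * j + 1)
      = ∑ l ∈ range ((n - 1) / 2), (if i ≤ l then frontCross N l else 0)
        * colDiff N (2 * l + 2) (2 * j + 1) := by
    refine sum_congr rfl fun l hl => ?_
    have := mem_range.1 hl
    rw [H.colDiff_odd_odd hi (by omega)]
  have e3 : ∑ l ∈ range ((n - 1) / 2), (if i ≤ l then frontCross N l else 0)
        * colDiff N (2 * l + 2) (2 * j + 1)
      + ∑ l ∈ range i, frontCross N l * colDiff N (2 * l + 2) (2 * j + 1)
      = ∑ l ∈ range ((n - 1) / 2), frontCross N l * colDiff N (2 * l + 2) (2 * j + 1) := by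
    rw [← sum_range_add_sum_Ico _ (show i ≤ (n - 1) / 2 by omega),
      ← sum_range_add_sum_Ico (fun l => frontCross N l * _) (show i ≤ (n - 1) / 2 by omega)]
    rw [sum_eq_zero (s := range i), zero_add, add_comm]
    · congr 1
      refine sum_congr rfl fun l hl => ?_
      rw [if_pos (mem_Ico.1 hl).1]
    · intro l hl
      rw [if_neg (by have := mem_range.1 hl; omega), zero_mul]
  rw [crossSum]
  grind

theorem crossSum_even {k j : ℕ} (hk : 2 * k ≤ n) (hj : 2 * j + 2 < n) :
    crossSum N (2 * k) j = colDiff N (2 * k) (2 * j + 1)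
      + frontCross N j * ∑ i ∈ range (min k (j + 1)), colDiff N (2 * i + 2) (2 * i) := by
  rw [crossSum]
  congr 2
  rw [← sum_subset (range_subset_range.2 (min_le_right k (j + 1)))]
  · refine sum_congr rfl fun i hi => ?_
    have := mem_range.1 hi
    rw [H.colDiff_even_even hk (by omega), if_pos (by omega)]
  · intro i hi hi'
    rw [mem_range] at hi hi'
    rw [H.colDiff_even_even hk (by omega), if_neg (by omega)]

theorem row_prevTube {q t : ℕ} (hq : 2 * q < n + 1) (ht : 2 * t + 2 < n)
    (h : q = 0 ∨ ∃ r, q = r + 1 ∧ frontCross N r = 1) :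
    crossSum N (2 * q - 1 + 1) t + crossSum N (2 * q - 1) t
      = frontCross N t * ∑ i ∈ range (min q (t + 1)), colDiff N (2 * i + 2) (2 * i)
        + ∑ l ∈ range ((n - 1) / 2), frontCross N l * colDiff N (2 * l + 2) (2 * t + 1)
        + ∑ l ∈ range q, frontCross N l * colDiff N (2 * l + 2) (2 * t + 1) := by
  rcases h with rfl | ⟨r, rfl, hr⟩
  · have := H.crossSum_odd (i := 0) (by omega) ht
    have h0 : crossSum N 0 t = 0 := by simp [crossSum, colDiff]
    simp [h0, this]
  · rw [show 2 * (r + 1) - 1 = 2 * r + 1 by omega, H.crossSum_odd (by omega) ht,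
      show 2 * r + 1 + 1 = 2 * (r + 1) by ring, H.crossSum_even (by omega) ht,
      sum_range_succ _ r, hr]
    rw [show 2 * (r + 1) = 2 * r + 2 by ring]
    grind

theorem row_upper {l t : ℕ} (hl : 2 * l + 2 < n) (ht : 2 * t + 2 < n) :
    crossSum N (2 * l + 2 + 1) t + crossSum N (2 * l + 2) t
      = frontCross N t * ∑ i ∈ range (min (l + 1) (t + 1)), colDiff N (2 * i + 2) (2 * i)
        + ∑ l ∈ range ((n - 1) / 2), frontCross N l * colDiff N (2 * l + 2) (2 * t + 1)
        + ∑ l ∈ range l, frontCross N l * colDiff N (2 * l + 2) (2 * t + 1)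
        + (frontCross N l + 1) * colDiff N (2 * l + 2) (2 * t + 1) := by
  rw [show 2 * l + 2 = 2 * (l + 1) by ring, H.crossSum_odd (by omega) ht,
      H.crossSum_even (by omega) ht, sum_range_succ _ l]
  rw [show 2 * (l + 1) = 2 * l + 2 by ring]
  grind

theorem row_pair {l t : ℕ} (hl : 2 * l + 2 < n) (ht : 2 * t + 2 < n) :
    crossSum N (lowerEnd (frontCross N) l + 1) t + crossSum N (lowerEnd (frontCross N) l) t
      + (crossSum N (2 * l + 2 + 1) t + crossSum N (2 * l + 2) t)
      = if frontCross N l = 0 then 0 else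
        frontCross N t *
          (∑ i ∈ range (min (prevTube (frontCross N) l) (t + 1)), colDiff N (2 * i + 2) (2 * i)
            + ∑ i ∈ range (min (l + 1) (t + 1)), colDiff N (2 * i + 2) (2 * i)) := by
  rw [lowerEnd]
  split_ifs with h
  · rw [show 2 * l + 2 + 1 = 2 * (l + 1) + 1 by ring, H.crossSum_odd (by omega) ht,
      H.crossSum_odd (by omega) ht, sum_range_succ _ l, h]
    grind
  · have hp := prevTube_le (frontCross N) l
    rw [H.row_upper hl ht, H.row_prevTube (by omega) ht, sum_range_prevTube,
      ZMod.eq_one_of_ne_zero h]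
    · grind
    · rcases prevTube_eq_zero_or (frontCross N) l with h | ⟨q, -, h⟩
      exacts [.inl h, .inr ⟨q, h⟩]

/-- The new pairs are mutually unlinked. -/
theorem new_pairs_unlinked {l s : ℕ} (hl : 2 * l + 2 < n) (hs : 2 * s + 2 < n) (hls : l ≠ s) :
    N (lowerEnd (frontCross N) l) (lowerEnd (frontCross N) s)
      + N (2 * l + 2) (lowerEnd (frontCross N) s)
      + (N (lowerEnd (frontCross N) l) (2 * s + 2) + N (2 * l + 2) (2 * s + 2)) = 0 := by
  set ε := frontCross N
  set F : ℕ → ZMod 2 := fun k => ∑ i ∈ range k, colDiff N (2 * i + 2) (2 * i)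
  have h := column_relation (ε := ε) (X := fun a => N (lowerEnd ε l) a + N (2 * l + 2) a)
    (G := fun t => if ε l = 0 then 0 else F (min (prevTube ε l) t) + F (min (l + 1) t))
    (by simp [F]) (b := (n - 1) / 2) (fun t ht => by
      have h := H.row_pair hl (t := t) (by omega)
      rw [crossSum_succ_add, crossSum_succ_add] at h
      simp only [sum_add_distrib] at h ⊢
      simp only [mul_ite, mul_zero]
      rw [← h]
      ring) (t := s) (by omega)
  rw [h]
  split_ifs with h1 h2
  · rfl
  · simp
  · have hp := prevTube_le ε s
    have hp' := prevTube_le ε l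
    rcases lt_or_gt_of_ne hls with h | h
    · have := lt_prevTube h h2
      rw [min_eq_left (by omega), min_eq_left (by omega), min_eq_left (by omega),
        min_eq_left (by omega)]
      grind
    · have := lt_prevTube h h1
      rw [min_eq_right (by omega), min_eq_right (by omega), min_eq_right (by omega),
        min_eq_right (by omega)]
      grind

/-- When `n` is even, the last position does not separate any of the new pairs. -/
theorem last_new_pairs (hn : n % 2 = 0) {s : ℕ} (hs : 2 * s + 2 < n) :
    N (n - 1) (lowerEnd (frontCross N) s) + N (n - 1) (2 * s + 2) = 0 := by
  have h := column_relation (ε := frontCross N) (X := N (n - 1)) (G := fun _ => 0) rfl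
    (b := (n - 1) / 2) (fun t ht => by
      have htop : crossSum N n t = 0 := by
        rw [crossSum, H.colDiff_last (by omega), sum_eq_zero, mul_zero, add_zero]
        intro i hi
        exact H.colDiff_last (by have := mem_range.1 hi; omega)
      have hodd := H.crossSum_odd (i := (n - 1) / 2) (j := t) (by omega) (by omega)
      rw [CharTwo.add_self_eq_zero, show 2 * ((n - 1) / 2) + 1 = n - 1 by omega] at hodd
      rw [← crossSum_succ_add, hodd, show n - 1 + 1 = n by omega, htop]
      simp) (t := s) (by omega)
  rw [h]; simp

/-- Uncrossed pairs do not cross the new front position. -/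
theorem newFront_uncrossed {t : ℕ} (ht : 2 * t + 2 < n) (h : frontCross N t = 0) :
    N (2 * prevTube (frontCross N) ((n - 1) / 2) - 1) (2 * t + 1)
      + N (2 * prevTube (frontCross N) ((n - 1) / 2) - 1) (2 * t + 2) = 0 := by
  have hp := prevTube_le (frontCross N) ((n - 1) / 2)
  have h1 := H.row_prevTube (q := prevTube (frontCross N) ((n - 1) / 2)) (by omega) ht (by
    rcases prevTube_eq_zero_or (frontCross N) ((n - 1) / 2) with h | ⟨q, -, h⟩
    exacts [.inl h, .inr ⟨q, h⟩])
  rw [crossSum_succ_add, sum_range_prevTube, h] at h1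
  grind

end UnlinkedMatrix

/-- The new front position does not separate all of the new pairs coming from tubes. -/
theorem exists_newFront_uncrossed {n : ℕ} {N : ℕ → ℕ → ZMod 2}
    (hN : ∀ x < n, ∀ g < n, ∀ e < n, x ≠ g → x ≠ e → g ≠ e → N g x = N g e ∨ N e x = N e g)
    {b : ℕ} (hb : 2 * b < n) {l₀ : ℕ} (hl₀ : l₀ < b) (hε : frontCross N l₀ ≠ 0) :
    ∃ l < b, frontCross N l ≠ 0 ∧
      N (2 * prevTube (frontCross N) b - 1) (lowerEnd (frontCross N) l)
        = N (2 * prevTube (frontCross N) b - 1) (2 * l + 2) := by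
  have hne : ∀ q, frontCross N q ≠ 0 → N 0 (2 * q + 2) ≠ N 0 (2 * q + 1) := by
    intro q hq h
    rw [frontCross, h, CharTwo.add_self_eq_zero] at hq
    exact hq rfl
  by_contra! hcon
  obtain ⟨r, hr, hpr, hεr⟩ : ∃ r < b, prevTube (frontCross N) b = r + 1 ∧ frontCross N r = 1 := by
    rcases prevTube_eq_zero_or (frontCross N) b with h | h
    · have := lt_prevTube hl₀ hε; omega
    · exact h
  have hr0 : frontCross N r ≠ 0 := by rw [hεr]; decide
  rw [hpr, show 2 * (r + 1) - 1 = 2 * r + 1 by omega] at hcon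
  have main : ∀ l ≤ r, frontCross N l ≠ 0 → N (2 * r + 1) (2 * l + 2) ≠ N (2 * r + 1) 0 := by
    intro l
    induction l using Nat.strong_induction_on with
    | _ l ih =>
      intro hl hεl h
      have hc := hcon l (by omega) hεl
      rw [lowerEnd, if_neg hεl] at hc
      rcases prevTube_eq_zero_or (frontCross N) l with h0 | ⟨q, hq, hpq, hεq⟩
      · rw [h0] at hc
        exact hc h.symm
      · rw [hpq, show 2 * (q + 1) - 1 = 2 * q + 1 by omega] at hc
        have hq0 : frontCross N q ≠ 0 := by rw [hεq]; decide
        have h1 := (hN (2 * q + 1) (by omega) 0 (by omega) (2 * r + 1) (by omega) (by omega)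
          (by omega) (by omega)).resolve_right (by rw [← h]; exact hc)
        have h2 := (hN (2 * q + 2) (by omega) 0 (by omega) (2 * r + 1) (by omega) (by omega)
          (by omega) (by omega)).resolve_left (by rw [← h1]; exact hne q hq0)
        exact ih q hq (by omega) hq0 h2
  refine main r le_rfl hr0 ((hN (2 * r + 2) (by omega) 0 (by omega) (2 * r + 1) (by omega)
    (by omega) (by omega) (by omega)).resolve_left (hne r hr0))

/-- The reversal of the first `k + 1` natural numbers. -/
def revPerm (k : ℕ) : Equiv.Perm ℕ :=
  Function.Involutive.toPerm (fun t => if t ≤ k then k - t else t) (by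
    intro t; dsimp only; split_ifs <;> omega)

theorem revPerm_of_le {k t : ℕ} (h : t ≤ k) : revPerm k t = k - t := by
  change (if t ≤ k then k - t else t) = _; rw [if_pos h]

theorem revPerm_of_lt {k t : ℕ} (h : k < t) : revPerm k t = t := by
  change (if t ≤ k then k - t else t) = _; rw [if_neg (by omega)]

/-- `x, y` and `z, w` are the same unordered pair. -/
def SamePair (x y z w : ℕ) : Prop := (x = z ∧ y = w) ∨ (x = w ∧ y = z)

theorem exists_rejoining_perm (ε : ℕ → ZMod 2) (b : ℕ) :
    ∃ π : Equiv.Perm ℕ, (∀ t, 2 * b ≤ t → π t = t) ∧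
      (∀ i, ∃ i', SamePair (π (2 * i)) (π (2 * i + 1)) (2 * i') (2 * i' + 1)) ∧
      (∀ k < b, ∃ l < b, SamePair (π (2 * k + 1)) (π (2 * k + 2)) (lowerEnd ε l) (2 * l + 2)) ∧
      π 0 = 2 * prevTube ε b - 1 := by
  induction b with
  | zero => exact ⟨1, by simp, fun i => ⟨i, by simp [SamePair]⟩, by simp, by simp [prevTube]⟩
  | succ b ih =>
    obtain ⟨π, h1, h2, h3, h4⟩ := ih
    by_cases hε : ε b = 0
    · refine ⟨π, fun t ht => h1 t (by omega), h2, fun k hk => ?_, by rw [h4, prevTube, if_pos hε]⟩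
      rcases Nat.lt_succ_iff_lt_or_eq.1 hk with hk | rfl
      · obtain ⟨l, hl, h⟩ := h3 k hk
        exact ⟨l, by omega, h⟩
      · refine ⟨k, by omega, ?_⟩
        rw [h1 _ (by omega), h1 _ (by omega), lowerEnd, if_pos hε]
        exact .inl ⟨rfl, rfl⟩
    · refine ⟨(revPerm (2 * b + 1)).trans π, fun t ht => ?_, fun i => ?_, fun k hk => ?_, ?_⟩
      · rw [Equiv.trans_apply, revPerm_of_lt (by omega), h1 t (by omega)]
      · rw [Equiv.trans_apply, Equiv.trans_apply]
        by_cases hi : i ≤ b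
        · rw [revPerm_of_le (by omega), revPerm_of_le (by omega)]
          obtain ⟨i', h⟩ := h2 (b - i)
          refine ⟨i', ?_⟩
          rw [show 2 * b + 1 - 2 * i = 2 * (b - i) + 1 by omega,
            show 2 * b + 1 - (2 * i + 1) = 2 * (b - i) by omega]
          exact h.elim (fun h => .inr h.symm) (fun h => .inl h.symm)
        · rw [revPerm_of_lt (by omega), revPerm_of_lt (by omega)]
          exact h2 i
      · rw [Equiv.trans_apply, Equiv.trans_apply]
        rcases Nat.lt_succ_iff_lt_or_eq.1 hk with hk | rfl
        · rw [revPerm_of_le (by omega), revPerm_of_le (by omega)]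
          obtain ⟨l, hl, h⟩ := h3 (b - k - 1) (by omega)
          refine ⟨l, by omega, ?_⟩
          rw [show 2 * b + 1 - (2 * k + 1) = 2 * (b - k - 1) + 2 by omega,
            show 2 * b + 1 - (2 * k + 2) = 2 * (b - k - 1) + 1 by omega]
          exact h.elim (fun h => .inr h.symm) (fun h => .inl h.symm)
        · rw [revPerm_of_le le_rfl, revPerm_of_lt (by omega), Nat.sub_self, h4, h1 _ (by omega)]
          refine ⟨k, by omega, .inl ⟨?_, rfl⟩⟩
          rw [lowerEnd, if_neg hε]
      · rw [Equiv.trans_apply, revPerm_of_le (by omega), prevTube, if_neg hε, h1 _ (by omega)]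
        omega

/-- `s h x` is thought of as the side of the edge `h` on which the edge `x` lies. The property
holds for the edges of a tree: restricting to a finite set of edges and filling in the
diagonal suitably gives an idempotent matrix with odd columns. -/
def TreeLike {E : Type*} [DecidableEq E] (s : E → E → ZMod 2) : Prop :=
  ∀ D : Finset E, ∃ M : E → E → ZMod 2, (∀ h x, h ≠ x → M h x = s h x) ∧
    (∀ x ∈ D, ∑ h ∈ D, M h x = 1) ∧ ∀ h ∈ D, ∀ x ∈ D, ∑ u ∈ D, M h u * M u x = M h x

theorem TreeLike.eq_or_eq {E : Type*} [DecidableEq E] {s : E → E → ZMod 2} (hs : TreeLike s)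
    {x g e : E} (hxg : x ≠ g) (hxe : x ≠ e) (hge : g ≠ e) : s g x = s g e ∨ s e x = s e g := by
  obtain ⟨M, hM, hcol, hid⟩ := hs {x, g, e}
  simp only [sum_insert, mem_insert, mem_singleton, hxg, hxe, hge, or_self, not_false_eq_true,
    sum_singleton, forall_eq_or_imp, forall_eq] at hcol hid
  rw [← hM g x hxg.symm, ← hM g e hge, ← hM e x hxe.symm, ← hM e g hge.symm]
  generalize M x x = a11, M x g = a12, M x e = a13, M g x = a21, M g g = a22, M g e = a23,
    M e x = a31, M e g = a32, M e e = a33 at *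
  have hadd : ∀ x y : ZMod 2, x ≠ y → x = y + 1 := by decide
  have hsq : ∀ x : ZMod 2, x * x = x := by decide
  by_contra! h
  have e1 := hadd _ _ h.1
  have e2 := hadd _ _ h.2
  have h22 := hsq a22
  have h23 := hsq a23
  have h32 := hsq a32
  have h33 := hsq a33
  grind

/-- A numbering such that pairs of consecutive edges of equal parity are unlinked. -/
structure WeakNumbering {E : Type*} (s : E → E → ZMod 2) (m : ℕ) (f : ℕ → E) : Prop where
  inj : ∀ i < m, ∀ j < m, f i = f j → i = j
  weak : ∀ k a, k + 1 < m → a + 1 < m → k % 2 = a % 2 → k ≠ a →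
    s (f a) (f k) + s (f a) (f (k + 1)) + (s (f (a + 1)) (f k) + s (f (a + 1)) (f (k + 1))) = 0

/-- The first edge does not separate the consecutive pairs of odd parity. -/
def FrontFree {E : Type*} (s : E → E → ZMod 2) (m : ℕ) (f : ℕ → E) : Prop :=
  ∀ j, 2 * j + 2 < m → s (f 0) (f (2 * j + 1)) = s (f 0) (f (2 * j + 2))

/-- The last edge does not separate the consecutive pairs of the parity of its number. -/
def BackFree {E : Type*} (s : E → E → ZMod 2) (m : ℕ) (f : ℕ → E) : Prop :=
  ∀ k, k + 1 < m → k % 2 = (m - 1) % 2 → s (f (m - 1)) (f k) = s (f (m - 1)) (f (k + 1))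

/-- The number of pairs obstructing `FrontFree`. -/
def frontCount {E : Type*} (s : E → E → ZMod 2) (m : ℕ) (f : ℕ → E) : ℕ :=
  #{j ∈ range ((m - 1) / 2) | s (f 0) (f (2 * j + 1)) ≠ s (f 0) (f (2 * j + 2))}

namespace WeakNumbering

variable {E : Type*} {s : E → E → ZMod 2} {m : ℕ} {f : ℕ → E}

theorem ne (hf : WeakNumbering s m f) {i j : ℕ} (hi : i < m) (hj : j < m) (h : i ≠ j) :
    f i ≠ f j := fun h' => h (hf.inj i hi j hj h')

theorem exists_unlinkedMatrix [DecidableEq E] (hs : TreeLike s) (hf : WeakNumbering s m f)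
    {n : ℕ} (hn : n ≤ m) (hlast : n % 2 = 1 ∨ n = m ∧ BackFree s m f) :
    ∃ N : ℕ → ℕ → ZMod 2, UnlinkedMatrix n N ∧
      ∀ i < m, ∀ j < m, i ≠ j → N i j = s (f i) (f j) := by
  obtain ⟨M, hM, hcol, hid⟩ := hs ((range n).image f)
  have hinj : Set.InjOn f (range n) := by
    intro i hi j hj h
    simp only [coe_range, Set.mem_Iio] at hi hj
    exact hf.inj i (by omega) j (by omega) h
  have hN : ∀ i < m, ∀ j < m, i ≠ j → M (f i) (f j) = s (f i) (f j) :=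
    fun i hi j hj h => hM _ _ (hf.ne hi hj h)
  have hmem : ∀ {x}, x < n → f x ∈ (range n).image f :=
    fun hx => mem_image_of_mem f (mem_range.2 hx)
  refine ⟨fun i j => M (f i) (f j), ⟨fun x hx => ?_, fun h hh x hx => ?_, fun k a hk ha hp hka => ?_,
    ?_⟩, hN⟩
  · rw [← hcol _ (hmem hx), sum_image hinj]
  · rw [← hid _ (hmem hh) _ (hmem hx), sum_image hinj]
  · rw [hN a (by omega) k (by omega) (by omega), hN a (by omega) (k + 1) (by omega) (by omega),
      hN (a + 1) (by omega) k (by omega) (by omega),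
      hN (a + 1) (by omega) (k + 1) (by omega) (by omega)]
    exact hf.weak k a (by omega) (by omega) hp hka
  · refine or_iff_not_imp_left.2 fun h j hj => ?_
    obtain ⟨rfl, hb⟩ := hlast.resolve_left h
    rw [hN _ (by omega) _ (by omega) (by omega), hN _ (by omega) _ (by omega) (by omega),
      hb (2 * j + 1) (by omega) (by omega), CharTwo.add_self_eq_zero]

theorem exists_frontCount_lt [DecidableEq E] (hs : TreeLike s) (hf : WeakNumbering s m f)
    (hfr : ¬ FrontFree s m f) :
    ∃ g, WeakNumbering s m g ∧ frontCount s m g < frontCount s m f ∧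
      (BackFree s m f → BackFree s m g) := by
  have hfr' := hfr
  simp only [FrontFree, not_forall] at hfr'
  obtain ⟨l₀, hl₀, hcr⟩ := hfr'
  obtain ⟨n, hnm, hb, hlast, hnb⟩ : ∃ n ≤ m, (n - 1) / 2 = (m - 1) / 2 ∧
      (n % 2 = 1 ∨ n = m ∧ BackFree s m f) ∧ (m % 2 = 0 → BackFree s m f → n = m) := by
    by_cases h : m % 2 = 1 ∨ BackFree s m f
    · exact ⟨m, le_rfl, rfl, h.imp_right fun h => ⟨rfl, h⟩, fun _ _ => rfl⟩
    · push Not at h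
      exact ⟨m - 1, by omega, by omega, .inl (by omega), fun _ h' => absurd h' h.2⟩
  obtain ⟨N, H, hN⟩ := hf.exists_unlinkedMatrix hs hnm hlast
  obtain ⟨π, h1, h2, h3, h4⟩ := exists_rejoining_perm (frontCross N) ((n - 1) / 2)
  set b := (n - 1) / 2 with hbdef
  have hπ : ∀ t < m, π t < m := by
    intro t ht
    by_contra h
    have := π.injective (h1 (π t) (by omega))
    omega
  have hcross : ∀ j < b, (frontCross N j ≠ 0 ↔
      s (f 0) (f (2 * j + 1)) ≠ s (f 0) (f (2 * j + 2))) := by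
    intro j hj
    rw [frontCross, hN _ (by omega) _ (by omega) (by omega), hN _ (by omega) _ (by omega)
      (by omega), Ne, CharTwo.add_eq_zero]
  have hpp : ∀ i < m, ∀ j < m, i ≠ j → s (f (π i)) (f (π j)) = N (π i) (π j) :=
    fun i hi j hj h => (hN _ (hπ i hi) _ (hπ j hj) (fun h' => h (π.injective h'))).symm
  choose! A hA using h2
  choose! L hLb hL using h3
  have hAinj : ∀ i j, A i = A j → i = j := by
    intro i j h
    have hi := hA i
    have hj := hA j
    rw [← h] at hj
    rcases hi with ⟨hi, -⟩ | ⟨hi, -⟩ <;> rcases hj with ⟨hj, hj'⟩ | ⟨hj, hj'⟩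
    all_goals
      first
        | have := π.injective (hi.trans hj.symm); omega
        | have := π.injective (hi.trans hj'.symm); omega
  have hLinj : ∀ i < b, ∀ j < b, L i = L j → i = j := by
    intro i hib j hjb h
    have hi := hL i hib
    have hj := hL j hjb
    rw [← h] at hj
    rcases hi with ⟨hi, -⟩ | ⟨hi, -⟩ <;> rcases hj with ⟨hj, hj'⟩ | ⟨hj, hj'⟩
    all_goals
      first
        | have := π.injective (hi.trans hj.symm); omega
        | have := π.injective (hi.trans hj'.symm); omega
  refine ⟨f ∘ π, ⟨fun i hi j hj h => π.injective (hf.inj _ (hπ i hi) _ (hπ j hj) h),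
    fun k a hk ha hp hka => ?_⟩, ?_, fun hB k hk hp => ?_⟩
  · simp only [Function.comp_apply]
    rcases Nat.even_or_odd' k with ⟨i, rfl | rfl⟩
    · obtain ⟨j, rfl⟩ : ∃ j, a = 2 * j := ⟨a / 2, by omega⟩
      have hA1 := hA i
      have hA2 := hA j
      have hne : A i ≠ A j := fun h => hka (by rw [hAinj _ _ h])
      have p1 := hπ _ hk
      have p2 := hπ _ ha
      have p3 := hπ (2 * i) (by omega)
      have p4 := hπ (2 * j) (by omega)
      have hw := hf.weak (2 * A i) (2 * A j) (by rcases hA1 with h | h <;> omega)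
        (by rcases hA2 with h | h <;> omega) (by omega) (by omega)
      rcases hA1 with ⟨e1, e2⟩ | ⟨e1, e2⟩ <;> rcases hA2 with ⟨e3, e4⟩ | ⟨e3, e4⟩ <;>
        rw [e1, e2, e3, e4, ← hw] <;> ring
    · obtain ⟨j, rfl⟩ : ∃ j, a = 2 * j + 1 := ⟨a / 2, by omega⟩
      have hA1 := hL i (by omega)
      have hA2 := hL j (by omega)
      have hlb1 := hLb i (by omega)
      have hlb2 := hLb j (by omega)
      have hne : L i ≠ L j := fun h => hka (by rw [hLinj _ (by omega) _ (by omega) h])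
      have hw := H.new_pairs_unlinked (l := L j) (s := L i) (by omega) (by omega) hne.symm
      rw [hpp _ (by omega) _ (by omega) (by omega), hpp _ (by omega) _ (by omega) (by omega),
        hpp _ (by omega) _ (by omega) (by omega), hpp _ (by omega) _ (by omega) (by omega)]
      rcases hA1 with ⟨e1, e2⟩ | ⟨e1, e2⟩ <;> rcases hA2 with ⟨e3, e4⟩ | ⟨e3, e4⟩ <;>
        rw [e1, e2, e3, e4, ← hw] <;> ring
  · have hN3 : ∀ x < n, ∀ g < n, ∀ e < n, x ≠ g → x ≠ e → g ≠ e →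
        N g x = N g e ∨ N e x = N e g := by
      intro x hx g hg e he hxg hxe hge
      rw [hN _ (by omega) _ (by omega) hxg.symm, hN _ (by omega) _ (by omega) hge,
        hN _ (by omega) _ (by omega) hxe.symm, hN _ (by omega) _ (by omega) hge.symm]
      exact hs.eq_or_eq (hf.ne (by omega) (by omega) hxg) (hf.ne (by omega) (by omega) hxe)
        (hf.ne (by omega) (by omega) hge)
    obtain ⟨l₁, hl₁, hε₁, hun⟩ := exists_newFront_uncrossed hN3 (b := b) (by omega)
      (l₀ := l₀) (by omega) ((hcross l₀ (by omega)).2 hcr)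
    have hkey : ∀ k < b, s (f (π 0)) (f (π (2 * k + 1))) ≠ s (f (π 0)) (f (π (2 * k + 2))) →
        frontCross N (L k) ≠ 0 ∧ L k ≠ l₁ := by
      intro k hk hne
      rw [hpp _ (by omega) _ (by omega) (by omega), hpp _ (by omega) _ (by omega) (by omega),
        h4] at hne
      have hLk := hL k hk
      have hne' : N (2 * prevTube (frontCross N) b - 1) (lowerEnd (frontCross N) (L k))
          ≠ N (2 * prevTube (frontCross N) b - 1) (2 * L k + 2) := by
        rcases hLk with ⟨e1, e2⟩ | ⟨e1, e2⟩
        · rwa [e1, e2] at hne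
        · rw [e1, e2] at hne; exact hne.symm
      constructor
      · intro h0
        have := H.newFront_uncrossed (t := L k) (by have := hLb k hk; omega) h0
        rw [lowerEnd, if_pos h0] at hne'
        exact hne' ((CharTwo.add_eq_zero).1 this)
      · rintro rfl
        exact hne' hun
    simp only [frontCount, Function.comp_apply, ← hb]
    set T := {j ∈ range b | s (f 0) (f (2 * j + 1)) ≠ s (f 0) (f (2 * j + 2))}
    have hlT : l₁ ∈ T := mem_filter.2 ⟨mem_range.2 hl₁, (hcross l₁ hl₁).1 hε₁⟩
    refine lt_of_le_of_lt (card_le_card_of_injOn L (t := T.erase l₁) ?_ ?_)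
      (card_erase_lt_of_mem hlT)
    · intro k hk
      rw [mem_coe, mem_filter, mem_range] at hk
      obtain ⟨h5, h6⟩ := hkey k hk.1 hk.2
      have h7 := hLb k hk.1
      exact mem_coe.2 (mem_erase.2 ⟨h6, mem_filter.2 ⟨mem_range.2 h7, (hcross _ h7).1 h5⟩⟩)
    · intro i hi j hj h
      rw [mem_coe, mem_filter, mem_range] at hi hj
      exact hLinj i hi.1 j hj.1 h
  · simp only [Function.comp_apply]
    have hm1 : π (m - 1) = m - 1 := h1 _ (by omega)
    rcases Nat.even_or_odd' k with ⟨i, rfl | rfl⟩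
    · have hA1 := hA i
      have p1 := hπ _ hk
      have p3 := hπ (2 * i) (by omega)
      have hB' := hB (2 * A i) (by rcases hA1 with h | h <;> omega) (by omega)
      rw [hm1]
      rcases hA1 with ⟨e1, e2⟩ | ⟨e1, e2⟩
      · rw [e1, e2, hB']
      · rw [e1, e2, hB']
    · have hnm' := hnb (by omega) hB
      have hlb := hLb i (by omega)
      have := H.last_new_pairs (by omega) (s := L i) (by omega)
      rw [hpp _ (by omega) _ (by omega) (by omega), hpp _ (by omega) _ (by omega) (by omega),
        hm1, ← hnm']
      rcases hL i (by omega) with ⟨e1, e2⟩ | ⟨e1, e2⟩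
      · rw [e1, e2, CharTwo.add_eq_zero.1 this]
      · rw [e1, e2, CharTwo.add_eq_zero.1 this]

theorem exists_frontFree [DecidableEq E] (hs : TreeLike s) (hf : WeakNumbering s m f) :
    ∃ g, WeakNumbering s m g ∧ FrontFree s m g ∧ (BackFree s m f → BackFree s m g) := by
  induction hc : frontCount s m f using Nat.strong_induction_on generalizing f with
  | _ c ih =>
    by_cases h : FrontFree s m f
    · exact ⟨f, hf, h, id⟩
    · obtain ⟨g, hg, hlt, hB⟩ := hf.exists_frontCount_lt hs h
      obtain ⟨g', h1, h2, h3⟩ := ih _ (hc ▸ hlt) hg rfl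
      exact ⟨g', h1, h2, h3 ∘ hB⟩

theorem reverse (hf : WeakNumbering s m f) : WeakNumbering s m (fun i => f (m - 1 - i)) where
  inj i hi j hj h := by
    have := hf.inj _ (by omega) _ (by omega) h
    omega
  weak k a hk ha hp hka := by
    have h := hf.weak (m - 1 - (k + 1)) (m - 1 - (a + 1)) (by omega) (by omega) (by omega)
      (by omega)
    rw [show m - 1 - (k + 1) + 1 = m - 1 - k by omega,
      show m - 1 - (a + 1) + 1 = m - 1 - a by omega] at h
    rw [← h]
    ring

theorem exists_frontFree_backFree [DecidableEq E] (hs : TreeLike s) (hf : WeakNumbering s m f) :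
    ∃ g, WeakNumbering s m g ∧ FrontFree s m g ∧ BackFree s m g := by
  obtain ⟨g, hg, hF, -⟩ := hf.exists_frontFree hs
  obtain ⟨g', hg', hF', hB'⟩ := hg.reverse.exists_frontFree hs
  refine ⟨g', hg', hF', hB' fun k hk hp => ?_⟩
  have h := hF ((m - 1 - (k + 1)) / 2) (by omega)
  rw [show 2 * ((m - 1 - (k + 1)) / 2) + 1 = m - 1 - (k + 1) by omega,
    show 2 * ((m - 1 - (k + 1)) / 2) + 2 = m - 1 - k by omega] at h
  simp only [Nat.sub_self]
  exact h.symm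

end WeakNumbering

namespace SimpleGraph

variable {V : Type*} {G : SimpleGraph V}

open Classical in
/-- The side of the edge `h` on which the vertex `v` lies, seen from the root `r`. -/
noncomputable def edgeSide (G : SimpleGraph V) (r : V) (h : Sym2 V) (v : V) : ZMod 2 :=
  if (G.deleteEdges {h}).Reachable r v then 0 else 1

theorem edgeSide_root (G : SimpleGraph V) (r : V) (h : Sym2 V) : G.edgeSide r h r = 0 := by
  simp [edgeSide]

theorem edgeSide_eq_of_adj {r v w : V} {h : Sym2 V} (hvw : G.Adj v w) (hne : h ≠ s(v, w)) :
    G.edgeSide r h v = G.edgeSide r h w := by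
  have hadj : (G.deleteEdges {h}).Adj v w := by
    rw [deleteEdges_adj]
    exact ⟨hvw, fun h' => hne (Set.mem_singleton_iff.1 h').symm⟩
  have hiff : (G.deleteEdges {h}).Reachable r v ↔ (G.deleteEdges {h}).Reachable r w :=
    ⟨fun h => h.trans hadj.reachable, fun h => h.trans hadj.symm.reachable⟩
  classical
  exact if_congr hiff rfl rfl

theorem edgeSide_add_of_adj (hT : G.IsTree) (r : V) {v w : V} (hvw : G.Adj v w) :
    G.edgeSide r s(v, w) v + G.edgeSide r s(v, w) w = 1 := by
  have hbridge := isAcyclic_iff_forall_adj_isBridge.1 hT.2 hvw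
  rw [isBridge_iff] at hbridge
  have hsome : (G.deleteEdges {s(v, w)}).Reachable r v ∨
      (G.deleteEdges {s(v, w)}).Reachable r w := by
    by_contra! hcon
    have hall : ∀ u x : V, G.Walk u x → (G.deleteEdges {s(v, w)}).Reachable r u →
        (G.deleteEdges {s(v, w)}).Reachable r x := by
      intro u x p
      induction p with
      | nil => exact id
      | @cons a b c hab p ih =>
        intro ha
        refine ih (ha.trans (Adj.reachable ?_))
        rw [deleteEdges_adj]
        refine ⟨hab, fun h => ?_⟩
        rw [Set.mem_singleton_iff, Sym2.eq_iff] at h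
        rcases h with ⟨rfl, -⟩ | ⟨rfl, -⟩
        exacts [hcon.1 ha, hcon.2 ha]
    obtain ⟨p⟩ := hT.1.preconnected r v
    exact hcon.1 (hall r v p (Reachable.refl r))
  unfold edgeSide
  split_ifs with h1 h2 h2
  · exact absurd (h1.symm.trans h2) (by simpa using hbridge)
  · rfl
  · rfl
  · exact absurd hsome (not_or.2 ⟨h1, h2⟩)

theorem edgeSide_eq_of_mem {r u v : V} {h e : Sym2 V} (he : e ∈ G.edgeSet) (hne : h ≠ e)
    (hu : u ∈ e) (hv : v ∈ e) : G.edgeSide r h u = G.edgeSide r h v := by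
  induction e with
  | _ a b =>
    have := edgeSide_eq_of_adj (r := r) ((G.mem_edgeSet).1 he) hne
    rw [Sym2.mem_iff] at hu hv
    rcases hu with rfl | rfl <;> rcases hv with rfl | rfl <;> simp [this]

theorem edgeSide_add_eq_count [DecidableEq V] (hT : G.IsTree) (r : V) (h : Sym2 V) {u v : V}
    (p : G.Walk u v) : G.edgeSide r h u + G.edgeSide r h v = (p.edges.count h : ZMod 2) := by
  induction p with
  | nil => simp [CharTwo.add_self_eq_zero]
  | @cons a b c hab p ih =>
    rw [Walk.edges_cons, List.count_cons, Nat.cast_add, ← ih]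
    by_cases hh : h = s(a, b)
    · have := edgeSide_add_of_adj hT r hab
      subst hh
      simp only [BEq.rfl, if_true, Nat.cast_one]
      grind
    · rw [edgeSide_eq_of_adj hab hh, if_neg (by simpa using Ne.symm hh)]
      simp

theorem mem_edges_iff_edgeSide_ne (hT : G.IsTree) (r : V) (h : Sym2 V) {u v : V}
    {p : G.Walk u v} (hp : p.IsPath) :
    h ∈ p.edges ↔ G.edgeSide r h u ≠ G.edgeSide r h v := by
  classical
  have h1 := edgeSide_add_eq_count hT r h p
  by_cases hm : h ∈ p.edges
  · rw [List.count_eq_one_of_mem hp.isTrail.edges_nodup hm, Nat.cast_one] at h1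
    refine iff_of_true hm fun h2 => ?_
    rw [h2, CharTwo.add_self_eq_zero] at h1
    exact absurd h1 (by decide)
  · rw [List.count_eq_zero_of_not_mem hm, Nat.cast_zero, CharTwo.add_eq_zero] at h1
    exact iff_of_false hm (not_not.2 h1)

/-- The side of the edge `h` on which (an endpoint of) the edge `x` lies. -/
noncomputable def edgeEdgeSide (G : SimpleGraph V) (r : V) (h x : G.edgeSet) : ZMod 2 :=
  G.edgeSide r h (Quot.out (x : Sym2 V)).1

theorem edgeSide_eq_edgeEdgeSide {r u : V} {h x : G.edgeSet} (hne : h ≠ x)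
    (hu : u ∈ (x : Sym2 V)) : G.edgeSide r h u = G.edgeEdgeSide r h x :=
  edgeSide_eq_of_mem x.2 (fun h' => hne (Subtype.ext h')) hu (Sym2.out_fst_mem _)

theorem edgeSide_add_adj_eq [DecidableEq V] (hT : G.IsTree) (r : V) {v w : V} (hvw : G.Adj v w)
    (h : G.edgeSet) : G.edgeSide r h v + G.edgeSide r h w
      = if h = ⟨s(v, w), hvw⟩ then 1 else 0 := by
  split_ifs with hh
  · subst hh; exact edgeSide_add_of_adj hT r hvw
  · rw [edgeSide_eq_of_adj hvw (fun h' => hh (Subtype.ext h')), CharTwo.add_self_eq_zero]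

theorem sum_edgeSide_add_adj [DecidableEq V] (hT : G.IsTree) (r : V) {v w : V}
    (hvw : G.Adj v w) (D : Finset G.edgeSet) (c : G.edgeSet → ZMod 2) :
    ∑ h ∈ D, c h * G.edgeSide r h v + ∑ h ∈ D, c h * G.edgeSide r h w
      = if ⟨s(v, w), hvw⟩ ∈ D then c ⟨s(v, w), hvw⟩ else 0 := by
  rw [← sum_add_distrib]
  simp only [← mul_add, edgeSide_add_adj_eq hT r hvw, mul_ite, mul_one, mul_zero, sum_ite_eq']

theorem treeLike_edgeEdgeSide [DecidableEq V] (hT : G.IsTree) (r : V) :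
    TreeLike (G.edgeEdgeSide r) := by
  intro D
  set col : V → ZMod 2 := fun v => ∑ h ∈ D, G.edgeSide r h v with hcol
  have hcoladd : ∀ {v w : V} (hvw : G.Adj v w),
      col v + col w = if (⟨s(v, w), hvw⟩ : G.edgeSet) ∈ D then 1 else 0 := by
    intro v w hvw
    simpa using sum_edgeSide_add_adj hT r hvw D 1
  have hend : ∀ x : G.edgeSet, ∃ v ∈ (x : Sym2 V), x ∈ D → col v = 1 := by
    rintro ⟨x, hx⟩
    induction x with
    | _ v w =>
      have hvw : G.Adj v w := hx
      by_cases hv : col v = 1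
      · exact ⟨v, Sym2.mem_mk_left v w, fun _ => hv⟩
      · refine ⟨w, Sym2.mem_mk_right v w, fun hD => ?_⟩
        have := hcoladd hvw
        rw [if_pos hD] at this
        have h2 : ∀ a b : ZMod 2, a ≠ 1 → a + b = 1 → b = 1 := by decide
        exact h2 _ _ hv this
  choose b hb hbD using hend
  refine ⟨fun h x => G.edgeSide r h (b x), fun h x hne => edgeSide_eq_edgeEdgeSide hne (hb x),
    fun x hx => hbD x hx, fun h hh x hx => ?_⟩
  have main : ∀ u v : V, G.Walk u v →
      ∑ e ∈ D, G.edgeSide r h (b e) * G.edgeSide r e u = col u * G.edgeSide r h u →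
      ∑ e ∈ D, G.edgeSide r h (b e) * G.edgeSide r e v = col v * G.edgeSide r h v := by
    intro u v p
    induction p with
    | nil => exact id
    | @cons u v c huv p ih =>
      intro hu
      refine ih ?_
      have h1 := sum_edgeSide_add_adj hT r huv D (fun e => G.edgeSide r h (b e))
      rw [hu] at h1
      have h2 := hcoladd huv
      have h3 := edgeSide_add_adj_eq hT r huv h
      by_cases hD : (⟨s(u, v), huv⟩ : G.edgeSet) ∈ D
      · rw [if_pos hD] at h1 h2
        have h4 := hbD _ hD
        have h5 := Sym2.mem_iff.1 (hb ⟨s(u, v), huv⟩)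
        rcases h5 with h5 | h5 <;> rw [h5] at h4 h1 <;> grind
      · rw [if_neg hD] at h1 h2
        rw [if_neg (show h ≠ ⟨s(u, v), huv⟩ from fun h' => hD (h' ▸ hh))] at h3
        grind
  obtain ⟨p⟩ := hT.1.preconnected r (b x)
  have := main r (b x) p (by simp [edgeSide_root])
  rw [this, hbD x hx, one_mul]

theorem exists_path_between (hT : G.IsTree) {e f : G.edgeSet} (hef : e ≠ f) :
    ∃ (u v : V) (p : G.Walk u v), p.IsPath ∧ u ∈ (e : Sym2 V) ∧ v ∈ (f : Sym2 V) ∧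
      (e : Sym2 V) ∉ p.edges ∧ (f : Sym2 V) ∉ p.edges := by
  classical
  have key : ∀ (r : V) (x : G.edgeSet) (c : ZMod 2), ∃ v ∈ (x : Sym2 V), G.edgeSide r x v = c := by
    rintro r ⟨x, hx⟩ c
    induction x with
    | _ v w =>
      have h := edgeSide_add_of_adj hT r (G.mem_edgeSet.1 hx)
      by_cases hv : G.edgeSide r s(v, w) v = c
      · exact ⟨v, Sym2.mem_mk_left v w, hv⟩
      · refine ⟨w, Sym2.mem_mk_right v w, ?_⟩
        have h2 : ∀ a b c : ZMod 2, a ≠ c → a + b = 1 → b = c := by decide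
        exact h2 _ _ _ hv h
  obtain ⟨r⟩ := hT.1.nonempty
  obtain ⟨u, hu, hue⟩ := key r e (G.edgeEdgeSide r e f)
  obtain ⟨v, hv, hvf⟩ := key r f (G.edgeEdgeSide r f e)
  obtain ⟨p, hp⟩ := (hT.1.preconnected u v).exists_isPath
  refine ⟨u, v, p, hp, hu, hv, ?_, ?_⟩
  · rw [mem_edges_iff_edgeSide_ne hT r _ hp, hue, edgeSide_eq_edgeEdgeSide hef hv]
    exact not_not.2 rfl
  · rw [mem_edges_iff_edgeSide_ne hT r _ hp, hvf, edgeSide_eq_edgeEdgeSide hef.symm hu]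
    exact not_not.2 rfl

theorem mem_edges_iff_edgeEdgeSide_ne (hT : G.IsTree) (r : V) {e f h : G.edgeSet} {u v : V}
    {p : G.Walk u v} (hp : p.IsPath) (hu : u ∈ (e : Sym2 V)) (hv : v ∈ (f : Sym2 V))
    (he : h ≠ e) (hf : h ≠ f) :
    (h : Sym2 V) ∈ p.edges ↔ G.edgeEdgeSide r h e ≠ G.edgeEdgeSide r h f := by
  rw [mem_edges_iff_edgeSide_ne hT r _ hp, edgeSide_eq_edgeEdgeSide he hu,
    edgeSide_eq_edgeEdgeSide hf hv]

end SimpleGraph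

theorem pathGraph_walk_parity {n : ℕ} {u v : Fin n} (p : (pathGraph n).Walk u v) :
    (u.val + v.val + p.length) % 2 = 0 := by
  induction p with
  | nil => rw [Walk.length_nil]; omega
  | cons h p ih =>
    rw [pathGraph_adj] at h
    rw [Walk.length_cons]
    omega

theorem even_pathGraph_dist_iff {m : ℕ} (P Q : Fin (m + 1)) :
    Even ((pathGraph (m + 1)).dist P Q) ↔ P.val % 2 = Q.val % 2 := by
  obtain ⟨p, hp⟩ := (pathGraph_connected m).exists_walk_length_eq_dist P Q
  have := pathGraph_walk_parity p
  rw [← hp, Nat.even_iff]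
  omega

/-- The `i`-th edge of the simple path. -/
def pathEdge (m : ℕ) (i : Fin m) : (pathGraph (m + 1)).edgeSet :=
  ⟨s(i.castSucc, i.succ), by
    rw [mem_edgeSet, pathGraph_adj]
    exact .inl rfl⟩

theorem pathEdge_bijective (m : ℕ) : Function.Bijective (pathEdge m) := by
  constructor
  · intro i j h
    have h := congrArg Subtype.val h
    simp only [pathEdge, Sym2.eq_iff, Fin.ext_iff, Fin.val_castSucc, Fin.val_succ] at h
    exact Fin.ext (by omega)
  · rintro ⟨e, he⟩
    induction e with
    | _ a b =>
      have hab := he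
      rw [mem_edgeSet, pathGraph_adj] at hab
      rcases hab with h | h
      · refine ⟨⟨a, by have := b.2; omega⟩, Subtype.ext (Sym2.eq_iff.2 ?_)⟩
        exact .inl ⟨Fin.ext rfl, Fin.ext h⟩
      · refine ⟨⟨b, by have := a.2; omega⟩, Subtype.ext (Sym2.eq_iff.2 ?_)⟩
        exact .inr ⟨Fin.ext rfl, Fin.ext h⟩

theorem mem_edgeImage_incidenceSet {V : Type*} {G : SimpleGraph V} {m : ℕ}
    (φ : (pathGraph (m + 1)).edgeSet → G.edgeSet) (P : Fin (m + 1)) (x : Sym2 V) :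
    x ∈ edgeImage φ ((pathGraph (m + 1)).incidenceSet P) ↔
      ∃ i : Fin m, (P.val = i ∨ P.val = i + 1) ∧ (φ (pathEdge m i) : Sym2 V) = x := by
  rw [edgeImage, Set.mem_ofPred_eq, (pathEdge_bijective m).surjective.exists]
  refine exists_congr fun i => and_congr_left fun _ => ?_
  rw [incidenceSet, Set.mem_sep_iff, and_iff_right (pathEdge m i).2]
  simp only [pathEdge, Sym2.mem_iff, Fin.ext_iff, Fin.val_castSucc, Fin.val_succ]

theorem countP_pair {α : Type*} [DecidableEq α] {q : Set α} {a b : α} (hab : a ≠ b)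
    (hq : ∀ x, x ∈ q ↔ x = a ∨ x = b) (l : List α) :
    l.countP (fun x => @decide (x ∈ q) (Classical.propDecidable _)) = l.count a + l.count b := by
  induction l with
  | nil => rfl
  | cons x l ih =>
    rw [List.countP_cons, ih, List.count_cons, List.count_cons]
    by_cases h1 : x = a
    · subst h1
      simp [hq, hab]
      omega
    · by_cases h2 : x = b
      · subst h2
        simp [hq, h1]
        omega
      · simp [hq, h1, h2]

theorem even_countP_pair {α : Type*} {q : Set α} {a b : α} (hab : a ≠ b)
    (hq : ∀ x, x ∈ q ↔ x = a ∨ x = b) {l : List α} (hl : l.Nodup) :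
    Even (l.countP (fun x => @decide (x ∈ q) (Classical.propDecidable _))) ↔
      (a ∈ l ↔ b ∈ l) := by
  classical
  rw [countP_pair hab hq, hl.count, hl.count, Nat.even_iff]
  by_cases h1 : a ∈ l <;> by_cases h2 : b ∈ l <;> simp [h1, h2]

theorem friendlyToPath_of_friendly {V : Type*} [Fintype V] [DecidableEq V]
    {G : SimpleGraph V} [DecidableRel G.Adj]
    (h : Friendly (pathGraph (G.edgeFinset.card + 1)) G) : FriendlyToPath G := by
  set m := G.edgeFinset.card
  obtain ⟨φ, hφ⟩ := h
  have hinj : Function.Injective (fun i => (φ (pathEdge m i) : Sym2 V)) :=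
    Subtype.val_injective.comp (φ.injective.comp (pathEdge_bijective m).injective)
  refine ⟨fun i => φ (pathEdge m i), fun i => mem_edgeFinset.2 (φ _).2, hinj,
    fun k a hk ha hp u v w hw hu hv hku hkv => ?_⟩
  rcases eq_or_ne k a with rfl | hka
  · exact iff_of_false hku hkv
  have hcatch := (hφ ⟨k + 1, by omega⟩ ⟨a + 1, by omega⟩ (by simpa using hka)
    ((even_pathGraph_dist_iff _ _).2 (by simp only; omega))).1.2
  have hmem : ∀ (c : ℕ) (hc : c + 1 < m) (x : Sym2 V),
      x ∈ edgeImage φ ((pathGraph (m + 1)).incidenceSet ⟨c + 1, by omega⟩) ↔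
        x = φ (pathEdge m ⟨c, by omega⟩) ∨ x = φ (pathEdge m ⟨c + 1, hc⟩) := by
    intro c hc x
    rw [mem_edgeImage_incidenceSet]
    constructor
    · rintro ⟨⟨i, hi⟩, h | h, rfl⟩
      · obtain rfl : c + 1 = i := h
        exact .inr rfl
      · obtain rfl : c = i := by simpa using h
        exact .inl rfl
    · rintro (rfl | rfl)
      exacts [⟨_, .inr rfl, rfl⟩, ⟨_, .inl rfl, rfl⟩]
  have hne : ∀ c (hc : c + 1 < m), (φ (pathEdge m ⟨c, by omega⟩) : Sym2 V)
      ≠ φ (pathEdge m ⟨c + 1, hc⟩) := fun c hc h => by simpa using hinj h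
  exact (even_countP_pair (hne a ha) (hmem a ha) hw.isTrail.edges_nodup).1
    (hcatch _ ((hmem k hk _).2 (.inl rfl)) _ ((hmem k hk _).2 (.inr rfl)) (hne k hk)
      u v w hw hu hv hku hkv)

theorem exists_weakNumbering {V : Type*} [Fintype V] [DecidableEq V]
    {G : SimpleGraph V} [DecidableRel G.Adj] (hT : G.IsTree) (r : V) (h : FriendlyToPath G)
    (hm : 0 < G.edgeFinset.card) :
    ∃ f, WeakNumbering (G.edgeEdgeSide r) G.edgeFinset.card f := by
  unfold FriendlyToPath at h
  set m := G.edgeFinset.card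
  obtain ⟨f, hf, hinj, hfr⟩ := h
  have hf' : ∀ i, f i ∈ G.edgeSet := fun i => mem_edgeFinset.1 (hf i)
  let g : ℕ → G.edgeSet := fun i => if hi : i < m then ⟨f ⟨i, hi⟩, hf' _⟩ else ⟨f ⟨0, hm⟩, hf' _⟩
  have hg : ∀ i (hi : i < m), g i = ⟨f ⟨i, hi⟩, hf' _⟩ := fun i hi => dif_pos hi
  have hginj : ∀ i < m, ∀ j < m, g i = g j → i = j := by
    intro i hi j hj h
    rw [hg i hi, hg j hj] at h
    simpa using hinj (congrArg Subtype.val h)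
  refine ⟨g, hginj, fun k a hk ha hp hka => ?_⟩
  have hne : ∀ i < m, ∀ j < m, i ≠ j → g i ≠ g j := fun i hi j hj h h' => h (hginj i hi j hj h')
  obtain ⟨u, v, p, hpath, hu, hv, hup, hvp⟩ :=
    exists_path_between hT (hne k (by omega) (k + 1) hk (by omega))
  have h1 := mem_edges_iff_edgeEdgeSide_ne hT r (h := g a) hpath hu hv
    (hne _ (by omega) _ (by omega) (by omega)) (hne _ (by omega) _ (by omega) (by omega))
  have h2 := mem_edges_iff_edgeEdgeSide_ne hT r (h := g (a + 1)) hpath hu hv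
    (hne _ (by omega) _ (by omega) (by omega)) (hne _ (by omega) _ (by omega) (by omega))
  have h3 := hfr k a hk ha hp.symm u v p hpath (by rwa [hg k (by omega)] at hu)
    (by rwa [hg (k + 1) hk] at hv) (by rwa [hg k (by omega)] at hup)
    (by rwa [hg (k + 1) hk] at hvp)
  rw [hg a (by omega)] at h1
  rw [hg (a + 1) ha] at h2
  have h4 := h1.symm.trans (h3.trans h2)
  rw [hg a (by omega), hg (a + 1) ha]
  have key : ∀ x y z w : ZMod 2, (x ≠ y ↔ z ≠ w) → x + y + (z + w) = 0 := by decide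
  exact key _ _ _ _ h4

theorem friendly_of_numbering {V : Type*} [Fintype V] [DecidableEq V]
    {G : SimpleGraph V} [DecidableRel G.Adj] (hT : G.IsTree) (r : V) {f : ℕ → G.edgeSet}
    (hf : WeakNumbering (G.edgeEdgeSide r) G.edgeFinset.card f)
    (hfront : FrontFree (G.edgeEdgeSide r) G.edgeFinset.card f)
    (hback : BackFree (G.edgeEdgeSide r) G.edgeFinset.card f) :
    Friendly (pathGraph (G.edgeFinset.card + 1)) G := by
  have hcard : Fintype.card G.edgeSet = G.edgeFinset.card := by rw [edgeFinset_card]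
  set m := G.edgeFinset.card
  have hbij : Function.Bijective (fun i : Fin m => f i) := by
    rw [Fintype.bijective_iff_injective_and_card]
    exact ⟨fun i j h => Fin.ext (hf.inj i i.2 j j.2 h), by rw [Fintype.card_fin, hcard]⟩
  let φ : (pathGraph (m + 1)).edgeSet ≃ G.edgeSet :=
    (Equiv.ofBijective _ (pathEdge_bijective m)).symm.trans (Equiv.ofBijective _ hbij)
  have hφ : ∀ i, φ (pathEdge m i) = f i := by
    intro i
    have : (Equiv.ofBijective _ (pathEdge_bijective m)).symm (pathEdge m i) = i :=
      (Equiv.ofBijective _ (pathEdge_bijective m)).symm_apply_apply i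
    rw [Equiv.trans_apply, this]
    rfl
  have hmem : ∀ (P : Fin (m + 1)) (x : Sym2 V),
      x ∈ edgeImage φ ((pathGraph (m + 1)).incidenceSet P) ↔
        ∃ i < m, (P.val = i ∨ P.val = i + 1) ∧ (f i : Sym2 V) = x := by
    intro P x
    rw [mem_edgeImage_incidenceSet]
    simp only [hφ]
    exact ⟨fun ⟨i, h⟩ => ⟨i, i.2, h⟩, fun ⟨i, hi, h⟩ => ⟨⟨i, hi⟩, h⟩⟩
  have hinj : ∀ i < m, ∀ j < m, (f i : Sym2 V) = f j → i = j :=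
    fun i hi j hj h => hf.inj i hi j hj (Subtype.ext h)
  have main : ∀ P Q : Fin (m + 1), P ≠ Q → P.val % 2 = Q.val % 2 →
      DoesNotCatch G (edgeImage φ ((pathGraph (m + 1)).incidenceSet P))
        (edgeImage φ ((pathGraph (m + 1)).incidenceSet Q)) := by
    intro P Q hPQ hpar
    have hPQ' : P.val ≠ Q.val := fun h => hPQ (Fin.ext h)
    refine ⟨Set.eq_empty_iff_forall_notMem.2 fun x hx => ?_, ?_⟩
    · obtain ⟨hx1, hx2⟩ := hx
      rw [hmem] at hx1 hx2
      obtain ⟨i, hi, hi', rfl⟩ := hx1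
      obtain ⟨j, hj, hj', h⟩ := hx2
      have := hinj _ hj _ hi h
      omega
    · intro e he e' he' hne u v w hw hu hv heu hev
      rw [hmem] at he he'
      obtain ⟨i, hi, hi', rfl⟩ := he
      obtain ⟨j, hj, hj', rfl⟩ := he'
      have hij : i ≠ j := fun h => hne (by rw [h])
      have hside : ∀ c < m, (Q.val = c ∨ Q.val = c + 1) →
          ((f c : Sym2 V) ∈ w.edges ↔ G.edgeEdgeSide r (f c) (f i) ≠ G.edgeEdgeSide r (f c) (f j)) :=
        fun c hc hQ => mem_edges_iff_edgeEdgeSide_ne hT r hw hu hv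
          (hf.ne hc hi (by omega)) (hf.ne hc hj (by omega))
      have hQ := Q.2
      have hsw : ∀ c < m, ∀ k, P.val = k + 1 → k + 1 < m →
          (G.edgeEdgeSide r (f c) (f i) ≠ G.edgeEdgeSide r (f c) (f j) ↔
          G.edgeEdgeSide r (f c) (f k) ≠ G.edgeEdgeSide r (f c) (f (k + 1))) := by
        intro c hc k hk hkm
        rcases (by omega : i = k ∧ j = k + 1 ∨ i = k + 1 ∧ j = k) with ⟨rfl, rfl⟩ | ⟨rfl, rfl⟩
        exacts [Iff.rfl, ne_comm]
      obtain ⟨k, hk⟩ : ∃ k, P.val = k + 1 := ⟨P.val - 1, by omega⟩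
      have hkm : k + 1 < m := by omega
      have heven : (∀ c < m, (Q.val = c ∨ Q.val = c + 1) →
          G.edgeEdgeSide r (f c) (f k) = G.edgeEdgeSide r (f c) (f (k + 1))) →
          Even (w.edges.countP (fun x => @decide
            (x ∈ edgeImage φ ((pathGraph (m + 1)).incidenceSet Q)) (Classical.propDecidable _))) := by
        intro hall
        rw [List.countP_eq_zero.2]
        · exact Even.zero
        · intro x hx hxq
          have hxq := @of_decide_eq_true _ (Classical.propDecidable _) hxq
          rw [hmem] at hxq
          obtain ⟨c, hc, hcQ, rfl⟩ := hxq
          exact (hsw c hc k hk hkm).1 ((hside c hc hcQ).1 hx) (hall c hc hcQ)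
      rcases Nat.eq_zero_or_pos Q.val with h0 | hpos
      · refine heven fun c hc hcQ => ?_
        obtain rfl : c = 0 := by omega
        have := hfront (k / 2) (by omega)
        rwa [show 2 * (k / 2) + 1 = k by omega, show 2 * (k / 2) + 2 = k + 1 by omega] at this
      rcases eq_or_ne Q.val m with hlast | hlast
      · refine heven fun c hc hcQ => ?_
        obtain rfl : c = m - 1 := by omega
        exact hback k hkm (by omega)
      · obtain ⟨a, ha⟩ : ∃ a, Q.val = a + 1 := ⟨Q.val - 1, by omega⟩
        have ham : a + 1 < m := by omega
        rw [even_countP_pair (a := (f a : Sym2 V)) (b := f (a + 1))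
          (fun h => by have := hinj _ (by omega) _ ham h; omega) _ hw.isTrail.edges_nodup,
          hside a (by omega) (by omega), hside (a + 1) ham (by omega),
          hsw a (by omega) k hk hkm, hsw (a + 1) ham k hk hkm]
        · have key : ∀ x y z w : ZMod 2, x + y + (z + w) = 0 → (x ≠ y ↔ z ≠ w) := by decide
          exact key _ _ _ _ (hf.weak k a hkm ham (by omega) (by omega))
        · intro x
          rw [hmem]
          constructor
          · rintro ⟨c, hc, hcQ, rfl⟩
            rcases (by omega : c = a ∨ c = a + 1) with rfl | rfl
            exacts [.inl rfl, .inr rfl]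
          · rintro (rfl | rfl)
            exacts [⟨a, by omega, by omega, rfl⟩, ⟨a + 1, ham, by omega, rfl⟩]
  refine ⟨φ, fun P Q hPQ hev => ?_⟩
  have hpar := (even_pathGraph_dist_iff P Q).1 hev
  exact ⟨main P Q hPQ hpar, main Q P hPQ.symm hpar.symm⟩

theorem friendly_of_card_eq_zero {V : Type*} [Fintype V] {G : SimpleGraph V}
    [Fintype G.edgeSet] {m : ℕ} (hm : m = 0) (h : G.edgeFinset.card = 0) :
    Friendly (pathGraph (m + 1)) G := by
  subst hm
  have h1 : IsEmpty G.edgeSet := by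
    rw [← Fintype.card_eq_zero_iff, ← edgeFinset_card, h]
  have h2 : IsEmpty (pathGraph (0 + 1)).edgeSet :=
    ⟨fun e => (pathEdge_bijective 0).surjective e |>.elim fun i _ => i.elim0⟩
  exact ⟨Equiv.equivOfIsEmpty _ _, fun P Q hPQ => absurd (Subsingleton.elim (α := Fin 1) P Q) hPQ⟩

theorem friendly_of_friendlyToPath {V : Type*} [Fintype V] [DecidableEq V]
    {G : SimpleGraph V} [DecidableRel G.Adj] (hT : G.IsTree) (h : FriendlyToPath G) :
    Friendly (pathGraph (G.edgeFinset.card + 1)) G := by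
  rcases Nat.eq_zero_or_pos G.edgeFinset.card with h0 | hpos
  · exact friendly_of_card_eq_zero h0 h0
  · obtain ⟨r⟩ := hT.1.nonempty
    obtain ⟨f, hf⟩ := exists_weakNumbering hT r h hpos
    obtain ⟨g, hg, hF, hB⟩ := hf.exists_frontFree_backFree (treeLike_edgeEdgeSide hT r)
    exact friendly_of_numbering hT r hg hF hB

end

/-- A finite tree `G` is friendly to the simple path (in the sense of friendly numberings)
iff the simple path with `|E(G)|` edges is friendly to `G` (in the general sense of
friendly bijections of edge sets). -/
theorem friendlyToPath_iff_path_friendly {V : Type*} [Fintype V] [DecidableEq V]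
    (G : SimpleGraph V) [DecidableRel G.Adj] (hT : G.IsTree) :
    FriendlyToPath G ↔ Friendly (SimpleGraph.pathGraph (G.edgeFinset.card + 1)) G :=
  ⟨friendly_of_friendlyToPath hT, friendlyToPath_of_friendly⟩
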